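/- arXiv:2403.16283 — 2 statements merged into one kernel-verified Lean document; each statement's English description precedes it below -/
import Mathlib

section
/- Under the SITA assumption that T and Y₁ are conditionally independent given σ(X), if m is a σ(X)-measurable integrable version of E[Y₁ | σ(X)], then for every bounded σ(X)-measurable random variable w one has E[T·w·(Y₁ − m)] = 0. (This is the zero-bias identity for a correctly specified outcome regression model, used in the proof of the double robustness of μ̂₁_SEL1 and μ̂₁_SEL2.) -/
open MeasureTheory ProbabilityTheory

namespace ProbabilityTheory

variable {Ω : Type*} {m' mΩ : MeasurableSpace Ω} [StandardBorelSpace Ω] {μ : Measure Ω}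
  [IsFiniteMeasure μ] {hm' : m' ≤ mΩ}

/-- Conditionally independent random variables with values in countably generated spaces are
independent under almost every regular conditional probability. -/
lemma CondIndepFun.ae_indepFun_condExpKernel {β γ : Type*} [MeasurableSpace β]
    [MeasurableSpace γ] [MeasurableSpace.CountablyGenerated β]
    [MeasurableSpace.CountablyGenerated γ] {f : Ω → β} {g : Ω → γ}
    (h : CondIndepFun m' hm' f g μ) (hf : AEMeasurable f μ) (hg : AEMeasurable g μ) :
    ∀ᵐ ω ∂μ, IndepFun f g (condExpKernel μ m' ω) := by
  have hf' : ∀ᵐ ω ∂μ.trim hm', f =ᵐ[condExpKernel μ m' ω] hf.mk f :=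
    Measure.ae_ae_of_ae_comp (by rw [condExpKernel_comp_trim hm']; exact hf.ae_eq_mk)
  have hg' : ∀ᵐ ω ∂μ.trim hm', g =ᵐ[condExpKernel μ m' ω] hg.mk g :=
    Measure.ae_ae_of_ae_comp (by rw [condExpKernel_comp_trim hm']; exact hg.ae_eq_mk)
  have hmk : CondIndepFun m' hm' (hf.mk f) (hg.mk g) μ := Kernel.IndepFun.congr' h hf' hg'
  rw [condIndepFun_iff_map_prod_eq_prod_map_map hf.measurable_mk hg.measurable_mk] at hmk
  filter_upwards [ae_of_ae_trim hm' hmk, ae_of_ae_trim hm' hf', ae_of_ae_trim hm' hg']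
    with ω hω hfω hgω
  refine IndepFun.congr ?_ hfω.symm hgω.symm
  rw [indepFun_iff_map_prod_eq_prod_map_map hf.measurable_mk.aemeasurable
    hg.measurable_mk.aemeasurable]
  rwa [Kernel.prod_apply, Kernel.map_apply _ hf.measurable_mk,
    Kernel.map_apply _ hg.measurable_mk,
    Kernel.map_apply _ (hf.measurable_mk.prodMk hg.measurable_mk)] at hω

/-- The conditional expectation of a product of conditionally independent real random variables is
the product of their conditional expectations. -/
lemma CondIndepFun.condExp_mul {f g : Ω → ℝ} (h : CondIndepFun m' hm' f g μ)
    (hf : Integrable f μ) (hg : Integrable g μ) (hfg : Integrable (f * g) μ) :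
    μ[f * g | m'] =ᵐ[μ] μ[f | m'] * μ[g | m'] := by
  filter_upwards [h.ae_indepFun_condExpKernel hf.aemeasurable hg.aemeasurable,
    condExp_ae_eq_integral_condExpKernel hm' hf, condExp_ae_eq_integral_condExpKernel hm' hg,
    condExp_ae_eq_integral_condExpKernel hm' hfg, hf.condExpKernel_ae (m := m'),
    hg.condExpKernel_ae (m := m')] with ω hω hfω hgω hfgω hfi hgi
  rw [Pi.mul_apply, hfω, hgω, hfgω]
  exact hω.integral_mul_eq_mul_integral hfi.aestronglyMeasurable hgi.aestronglyMeasurable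

end ProbabilityTheory

/-- Zero-bias identity for a correctly specified outcome regression model: under SITA
(`T` and `Y₁` conditionally independent given `σ(X)`), if `m` is a `σ(X)`-measurable
integrable version of `E[Y₁ | σ(X)]`, then for every bounded `σ(X)`-measurable `w` one
has `E[T·w·(Y₁ - m)] = 0`. -/
theorem zero_bias_identity {Ω : Type*} [mΩ : MeasurableSpace Ω]
    [StandardBorelSpace Ω] [Nonempty Ω]
    {E : Type*} [mE : MeasurableSpace E]
    (μ : Measure Ω) [IsProbabilityMeasure μ]
    (X : Ω → E) (hX : Measurable X)
    (T : Ω → ℝ) (hTmeas : Measurable T) (hT01 : ∀ ω, T ω = 0 ∨ T ω = 1)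
    (Y1 : Ω → ℝ) (hY1 : Integrable Y1 μ)
    (hCI : CondIndepFun (mE.comap X) hX.comap_le T Y1 μ)
    (m : Ω → ℝ) (hmmeas : Measurable[mE.comap X] m) (hmint : Integrable m μ)
    (hmver : m =ᵐ[μ] μ[Y1 | mE.comap X])
    (w : Ω → ℝ) (hwmeas : Measurable[mE.comap X] w)
    (hwbd : ∃ C : ℝ, ∀ ω, |w ω| ≤ C) :
    ∫ ω, T ω * w ω * (Y1 ω - m ω) ∂μ = 0 := by
  obtain ⟨C, hC⟩ := hwbd
  have hm' : mE.comap X ≤ mΩ := hX.comap_le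
  have hTb : ∀ᵐ ω ∂μ, ‖T ω‖ ≤ 1 := .of_forall fun ω ↦ by
    rcases hT01 ω with h | h <;> simp [h]
  have hT : Integrable T μ := .of_bound hTmeas.aestronglyMeasurable 1 hTb
  have hTY : Integrable (T * Y1) μ := hY1.bdd_mul hTmeas.aestronglyMeasurable hTb
  have hTm : Integrable (T * m) μ := hmint.bdd_mul hTmeas.aestronglyMeasurable hTb
  have hres : μ[T * Y1 - T * m | mE.comap X] =ᵐ[μ] 0 := by
    filter_upwards [condExp_sub hTY hTm (mE.comap X), hCI.condExp_mul hT hY1 hTY,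
      condExp_mul_of_stronglyMeasurable_right hmmeas.stronglyMeasurable hTm hT, hmver]
      with ω h₁ h₂ h₃ h₄
    simp [h₁, h₂, h₃, h₄]
  have hw : μ[w * (T * Y1 - T * m) | mE.comap X] =ᵐ[μ] 0 := by
    filter_upwards [condExp_stronglyMeasurable_mul_of_bound hm' hwmeas.stronglyMeasurable
      (hTY.sub hTm) C (.of_forall hC), hres] with ω h₁ h₂
    simp [h₁, h₂]
  calc ∫ ω, T ω * w ω * (Y1 ω - m ω) ∂μ
      = ∫ ω, (w * (T * Y1 - T * m)) ω ∂μ := by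
        congr with ω
        simp only [Pi.mul_apply, Pi.sub_apply]
        ring
    _ = ∫ ω, (μ[w * (T * Y1 - T * m) | mE.comap X]) ω ∂μ := (integral_condExp hm').symm
    _ = 0 := by simp [integral_congr_ae hw]
end

section
/- Assume T is conditionally independent of the pair (Y₁, Y₀) given σ(X). Let m₁, m₀ be σ(X)-measurable integrable random variables and τ a σ(X)-measurable random variable with c₁ ≤ τ ≤ c₂ almost surely (0 < c₁ ≤ c₂ < 1). If EITHER (i) τ is a version of E[T | σ(X)], OR (ii) m₁ is a version of E[Y₁ | σ(X)] and m₀ is a version of E[Y₀ | σ(X)], then E[ m₁ + T·(Y₁ − m₁)/τ − m₀ − (1−T)·(Y₀ − m₀)/(1−τ) ] = E[Y₁] − E[Y₀] = θ, the average treatment effect. (Double robustness of the augmented IPW estimand for the ATE.) -/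
open MeasureTheory ProbabilityTheory

/-- Conditional independence is preserved by almost sure modification of the second variable. -/
lemma ProbabilityTheory.CondIndepFun.congr_right {Ω β γ : Type*} {m mΩ : MeasurableSpace Ω}
    [StandardBorelSpace Ω] {hm : m ≤ mΩ} {μ : Measure Ω} [IsFiniteMeasure μ]
    [MeasurableSpace β] [MeasurableSpace γ] {f : Ω → β} {g g' : Ω → γ}
    (h : CondIndepFun m hm f g μ) (hg : g =ᵐ[μ] g') : CondIndepFun m hm f g' μ := by
  refine Kernel.IndepFun.congr' h (Filter.Eventually.of_forall fun _ => Filter.EventuallyEq.rfl) ?_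
  refine Measure.ae_ae_of_ae_comp ?_
  rwa [condExpKernel_comp_trim]

/-- The conditional expectation of a product of conditionally independent real random variables
is the product of the conditional expectations. -/
lemma ProbabilityTheory.CondIndepFun.condExp_mul_s15 {Ω : Type*} {m mΩ : MeasurableSpace Ω}
    [StandardBorelSpace Ω] {hm : m ≤ mΩ} {μ : Measure Ω} [IsFiniteMeasure μ] {f g : Ω → ℝ}
    (h : CondIndepFun m hm f g μ) (hf : Measurable f) (hf_int : Integrable f μ)
    (hg_int : Integrable g μ) (hfg_int : Integrable (f * g) μ) :
    μ[f * g | m] =ᵐ[μ] μ[f | m] * μ[g | m] := by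
  set g' := hg_int.aemeasurable.mk g
  have hgg' : g =ᵐ[μ] g' := hg_int.aemeasurable.ae_eq_mk
  have hg'_meas : Measurable g' := hg_int.aemeasurable.measurable_mk
  have hmap := ae_of_ae_trim hm
    ((condIndepFun_iff_map_prod_eq_prod_map_map hf hg'_meas).1 (h.congr_right hgg'))
  have hfg' : f * g =ᵐ[μ] f * g' := Filter.EventuallyEq.rfl.mul hgg'
  filter_upwards [hmap, condExp_congr_ae (m := m) hfg', condExp_congr_ae (m := m) hgg',
    condExp_ae_eq_integral_condExpKernel hm (hfg_int.congr hfg'),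
    condExp_ae_eq_integral_condExpKernel hm hf_int,
    condExp_ae_eq_integral_condExpKernel hm (hg_int.congr hgg')] with ω h1 h2 h3 h4 h5 h6
  rw [Pi.mul_apply, h2, h3, h4, h5, h6]
  rw [Kernel.map_apply _ (by fun_prop), Kernel.prod_apply, Kernel.map_apply _ hf,
    Kernel.map_apply _ hg'_meas] at h1
  have hind : IndepFun f g' (condExpKernel μ m ω) :=
    (indepFun_iff_map_prod_eq_prod_map_map hf.aemeasurable hg'_meas.aemeasurable).2 h1
  exact hind.integral_mul_eq_mul_integral hf.aestronglyMeasurable hg'_meas.aestronglyMeasurable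

/-- Integrability of the inverse-probability-weighted residual. -/
lemma integrable_ipw_residual {Ω : Type*} {m mΩ : MeasurableSpace Ω} (hm : m ≤ mΩ)
    {μ : Measure Ω} {T Y r p : Ω → ℝ}
    (hT : Measurable T) (hT01 : ∀ ω, T ω = 0 ∨ T ω = 1) (hY : Integrable Y μ)
    (hr : Integrable r μ) (hp : Measurable[m] p) {c : ℝ} (hc : 0 < c) (hpc : ∀ᵐ ω ∂μ, c ≤ p ω) :
    Integrable (fun ω => T ω * (Y ω - r ω) / p ω) μ := by
  have hTbd : ∀ᵐ ω ∂μ, ‖T ω‖ ≤ 1 :=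
    .of_forall fun ω => by rcases hT01 ω with h | h <;> simp [h]
  have hpbd : ∀ᵐ ω ∂μ, ‖(p ω)⁻¹‖ ≤ c⁻¹ := by
    filter_upwards [hpc] with ω h
    rw [norm_inv, Real.norm_of_nonneg (hc.le.trans h)]
    gcongr
  have := ((hY.sub hr).bdd_mul hT.aestronglyMeasurable hTbd).bdd_mul
    (hp.mono hm le_rfl).inv.aestronglyMeasurable hpbd
  refine this.congr (.of_forall fun ω => ?_)
  simp [div_eq_inv_mul]

/-- Double robustness of the augmentation term for a single treatment arm. -/
lemma integral_ipw_residual {Ω : Type*} {m mΩ : MeasurableSpace Ω}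
    [StandardBorelSpace Ω] {hm : m ≤ mΩ} {μ : Measure Ω} [IsFiniteMeasure μ] {T Y r p : Ω → ℝ}
    (hT : Measurable T) (hT01 : ∀ ω, T ω = 0 ∨ T ω = 1) (hY : Integrable Y μ)
    (hTY : CondIndepFun m hm T Y μ) (hr_meas : Measurable[m] r)
    (hr : Integrable r μ) (hp : Measurable[m] p) {c : ℝ} (hc : 0 < c) (hpc : ∀ᵐ ω ∂μ, c ≤ p ω)
    (hpr : p =ᵐ[μ] μ[T | m] ∨ r =ᵐ[μ] μ[Y | m]) :
    ∫ ω, T ω * (Y ω - r ω) / p ω ∂μ = ∫ ω, Y ω ∂μ - ∫ ω, r ω ∂μ := by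
  have hTbd : ∀ᵐ ω ∂μ, ‖T ω‖ ≤ 1 :=
    .of_forall fun ω => by rcases hT01 ω with h | h <;> simp [h]
  have hTint : Integrable T μ := .of_bound hT.aestronglyMeasurable 1 hTbd
  have hTYint : Integrable (T * Y) μ := hY.bdd_mul hT.aestronglyMeasurable hTbd
  have hTrint : Integrable (T * r) μ := hr.bdd_mul hT.aestronglyMeasurable hTbd
  have hint := integrable_ipw_residual hm hT hT01 hY hr hp hc hpc
  have hrw : (fun ω => T ω * (Y ω - r ω) / p ω) = p⁻¹ * (T * Y - T * r) := by
    ext ω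
    simp only [Pi.mul_apply, Pi.sub_apply, Pi.inv_apply]
    ring
  have hcond : μ[fun ω => T ω * (Y ω - r ω) / p ω | m] =ᵐ[μ] μ[Y | m] - r := by
    rw [hrw] at hint ⊢
    have hpr' : ∀ᵐ ω ∂μ, p ω = (μ[T | m]) ω ∨ r ω = (μ[Y | m]) ω :=
      hpr.elim (fun h => h.mono fun _ => Or.inl) (fun h => h.mono fun _ => Or.inr)
    filter_upwards [hpc,
      condExp_mul_of_stronglyMeasurable_left hp.inv.stronglyMeasurable hint (hTYint.sub hTrint),
      condExp_sub hTYint hTrint m, hTY.condExp_mul_s15 hT hTint hY hTYint,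
      condExp_mul_of_stronglyMeasurable_right hr_meas.stronglyMeasurable hTrint hTint,
      hpr'] with ω h0 h1 h2 h3 h4 h5
    have hp0 : p ω ≠ 0 := (hc.trans_le h0).ne'
    simp only [Pi.mul_apply, Pi.sub_apply, Pi.inv_apply] at h1 h2 h3 h4 ⊢
    rw [h1, h2, h3, h4]
    rcases h5 with h | h
    · rw [← h]
      field_simp
    · rw [h]
      ring
  rw [← integral_condExp hm, integral_congr_ae hcond]
  simp only [Pi.sub_apply]
  rw [integral_sub integrable_condExp hr, integral_condExp hm]

/-- Double robustness of the augmented IPW estimand for the average treatment effect: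
under SITA (`T` conditionally independent of the pair `(Y₁, Y₀)` given `σ(X)`), with
`σ(X)`-measurable integrable working outcome regressions `m₁, m₀` and a `σ(X)`-measurable
working propensity score `τ` bounded in `[c₁, c₂] ⊆ (0, 1)`, if either `τ` is a version
of `E[T | σ(X)]`, or `m₁` and `m₀` are versions of `E[Y₁ | σ(X)]` and `E[Y₀ | σ(X)]`,
then `E[m₁ + T·(Y₁-m₁)/τ - m₀ - (1-T)·(Y₀-m₀)/(1-τ)] = E[Y₁] - E[Y₀]`, the ATE. -/
theorem aipw_doubly_robust_ate {Ω : Type*} [mΩ : MeasurableSpace Ω]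
    [StandardBorelSpace Ω] [Nonempty Ω]
    {E : Type*} [mE : MeasurableSpace E]
    (μ : Measure Ω) [IsProbabilityMeasure μ]
    (X : Ω → E) (hX : Measurable X)
    (T : Ω → ℝ) (hTmeas : Measurable T) (hT01 : ∀ ω, T ω = 0 ∨ T ω = 1)
    (Y1 Y0 : Ω → ℝ) (hY1 : Integrable Y1 μ) (hY0 : Integrable Y0 μ)
    (hCI : CondIndepFun (mE.comap X) hX.comap_le T (fun ω => (Y1 ω, Y0 ω)) μ)
    (m1 m0 : Ω → ℝ)
    (hm1meas : Measurable[mE.comap X] m1) (hm1int : Integrable m1 μ)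
    (hm0meas : Measurable[mE.comap X] m0) (hm0int : Integrable m0 μ)
    (τ : Ω → ℝ) (hτmeas : Measurable[mE.comap X] τ)
    (c₁ c₂ : ℝ) (hc₁ : 0 < c₁) (hc₁₂ : c₁ ≤ c₂) (hc₂ : c₂ < 1)
    (hτbd : ∀ᵐ ω ∂μ, c₁ ≤ τ ω ∧ τ ω ≤ c₂)
    (hDR : τ =ᵐ[μ] μ[T | mE.comap X] ∨
      (m1 =ᵐ[μ] μ[Y1 | mE.comap X] ∧ m0 =ᵐ[μ] μ[Y0 | mE.comap X])) :
    ∫ ω, (m1 ω + T ω * (Y1 ω - m1 ω) / τ ω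
        - m0 ω - (1 - T ω) * (Y0 ω - m0 ω) / (1 - τ ω)) ∂μ
      = ∫ ω, Y1 ω ∂μ - ∫ ω, Y0 ω ∂μ := by
  have hm := hX.comap_le
  have hTint : Integrable T μ := .of_bound hTmeas.aestronglyMeasurable 1
    (.of_forall fun ω => by rcases hT01 ω with h | h <;> simp [h])
  have hS01 : ∀ ω, 1 - T ω = 0 ∨ 1 - T ω = 1 := fun ω => by
    rcases hT01 ω with h | h <;> simp [h]
  have hSmeas : Measurable fun ω => 1 - T ω := hTmeas.const_sub 1
  have hCI1 : CondIndepFun (mE.comap X) hm T Y1 μ := hCI.comp measurable_id measurable_fst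
  have hCI0 : CondIndepFun (mE.comap X) hm (fun ω => 1 - T ω) Y0 μ :=
    hCI.comp (measurable_id.const_sub 1) measurable_snd
  have hτ1 : ∀ᵐ ω ∂μ, c₁ ≤ τ ω := hτbd.mono fun _ h => h.1
  have hτ0 : ∀ᵐ ω ∂μ, 1 - c₂ ≤ 1 - τ ω := hτbd.mono fun _ h => by linarith [h.2]
  have hσmeas : Measurable[mE.comap X] fun ω => 1 - τ ω := hτmeas.const_sub 1
  have hc : 0 < 1 - c₂ := by linarith
  have hcond : μ[fun ω => 1 - T ω | mE.comap X] =ᵐ[μ] fun ω => 1 - (μ[T | mE.comap X]) ω := by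
    filter_upwards [condExp_sub (integrable_const (1 : ℝ)) hTint (mE.comap X)] with ω h
    rw [condExp_const hm] at h
    exact h
  have hσ : τ =ᵐ[μ] μ[T | mE.comap X] →
      (fun ω => 1 - τ ω) =ᵐ[μ] μ[fun ω => 1 - T ω | mE.comap X] := fun h => by
    filter_upwards [h, hcond] with ω h1 h2
    rw [h1, h2]
  have hi1 := integrable_ipw_residual hm hTmeas hT01 hY1 hm1int hτmeas hc₁ hτ1
  have hi0 := integrable_ipw_residual hm hSmeas hS01 hY0 hm0int hσmeas hc hτ0
  have hi1' : Integrable (fun ω => m1 ω + T ω * (Y1 ω - m1 ω) / τ ω) μ := hm1int.add hi1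
  have hi10 : Integrable (fun ω => m1 ω + T ω * (Y1 ω - m1 ω) / τ ω - m0 ω) μ :=
    hi1'.sub hm0int
  rw [integral_sub hi10 hi0, integral_sub hi1' hm0int,
    integral_add hm1int hi1,
    integral_ipw_residual hTmeas hT01 hY1 hCI1 hm1meas hm1int hτmeas hc₁ hτ1
      (hDR.imp_right And.left),
    integral_ipw_residual hSmeas hS01 hY0 hCI0 hm0meas hm0int hσmeas hc hτ0
      (hDR.imp hσ And.right)]
  ring
end
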